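/- arXiv:2007.07302 — 2 statements merged into one kernel-verified Lean document; each statement's English description precedes it below -/
import Mathlib

section
/- Let P ∈ 𝒫, let x′ ∈ X̃_d(P) be a deceitful arm, and let η ≥ 0 be a nonnegative exploration rate. Then Dist(η,x′,P) is finite and equals the minimum (which is attained) of Σ_{x∈X̃(P)} η(x)·I(P(x),Q(x)) over all Q ∈ 𝒫 satisfying Q(x*(P)) = P(x*(P)) and Σ_{r∈𝔯} r·Q(r,x′) ≥ Rew*(P). -/
open scoped BigOperators Classical
open Filter

namespace Bandit

/-- Matrices indexed by rewards and arms; a reward distribution is such a matrix. -/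
abbrev RMat (R X : Type*) := R → X → ℝ

section Core

variable {R X : Type*} [Fintype R] [Fintype X] [Nonempty X]

/-- The set `𝒫_Ω` of all reward distributions. -/
def POmega : Set (RMat R X) :=
  {Q | (∀ r x, 0 ≤ Q r x) ∧ ∀ x : X, ∑ r : R, Q r x = 1}

/-- The interior of `T` in the topology relative to `S`. -/
def relIntIn (S T : Set (RMat R X)) : Set (RMat R X) :=
  {Q | Q ∈ T ∧ ∃ U : Set (RMat R X), IsOpen U ∧ Q ∈ U ∧ U ∩ S ⊆ T}

/-- Information distance `I(M', M)` between two nonnegative measures on a finite set. -/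
noncomputable def infoDiv {α : Type*} [Fintype α] (M' M : α → ℝ) : EReal :=
  if ∀ a, M a = 0 → M' a = 0 then
    ((∑ a : α, (M' a * Real.log (M' a / M a) - M' a + M a) : ℝ) : EReal)
  else ⊤

/-- Expected reward of arm `x` under reward distribution `Q` (reward values `v`). -/
def rewOf (v : R → ℝ) (Q : RMat R X) (x : X) : ℝ := ∑ r : R, v r * Q r x

/-- Optimal expected reward `Rew*`. -/
noncomputable def rewStar (v : R → ℝ) (Q : RMat R X) : ℝ :=
  Finset.univ.sup' Finset.univ_nonempty (rewOf v Q)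

/-- The set `x*(Q)` of optimal arms. -/
def optArms (v : R → ℝ) (Q : RMat R X) : Set X := {x | rewOf v Q x = rewStar v Q}

/-- The set `X̃(Q)` of suboptimal arms. -/
def subArms (v : R → ℝ) (Q : RMat R X) : Set X := {x | rewOf v Q x ≠ rewStar v Q}

noncomputable def optFinset (v : R → ℝ) (Q : RMat R X) : Finset X :=
  Finset.univ.filter fun x => rewOf v Q x = rewStar v Q

noncomputable def subFinset (v : R → ℝ) (Q : RMat R X) : Finset X :=
  Finset.univ.filter fun x => rewOf v Q x ≠ rewStar v Q

/-- The suboptimality gap `Δ(x, Q)`. -/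
noncomputable def gapOf (v : R → ℝ) (Q : RMat R X) (x : X) : ℝ := rewStar v Q - rewOf v Q x

/-- The set `Deceit(x', P)` of deceitful reward distributions. -/
def DeceitSet (v : R → ℝ) (PP : Set (RMat R X)) (x' : X) (P : RMat R X) :
    Set (RMat R X) :=
  {Q | Q ∈ PP ∧ (∀ x ∈ optArms v P, ∀ r, Q r x = P r x) ∧
    ∀ x ∈ optArms v P, rewOf v Q x < rewOf v Q x'}

/-- The objective `Σ_{x ∈ X̃(P)} η(x)·I(P(x), Q(x))`. -/
noncomputable def distObj (v : R → ℝ) (η : X → ℝ) (P Q : RMat R X) : EReal :=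
  ∑ x ∈ subFinset v P, ((η x : ℝ) : EReal) * infoDiv (fun r => P r x) (fun r => Q r x)

/-- The distance function `Dist(η, x', P)` (equal to `⊤` if `Deceit(x', P)` is empty). -/
noncomputable def DistFn (v : R → ℝ) (PP : Set (RMat R X)) (η : X → ℝ) (x' : X)
    (P : RMat R X) : EReal :=
  sInf (distObj v η P '' DeceitSet v PP x' P)

/-- The regret lower bound `C(P)`. -/
noncomputable def CFn (v : R → ℝ) (PP : Set (RMat R X)) (P : RMat R X) : EReal :=
  sInf {c : EReal | ∃ η : X → ℝ, (∀ x, 0 ≤ η x) ∧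
    (∀ x ∈ subArms v P, 1 ≤ DistFn v PP η x P) ∧
    c = ((∑ x ∈ subFinset v P, η x * gapOf v P x : ℝ) : EReal)}

/-- The maximal reward `Rew_max(x', P)` of arm `x'`. -/
noncomputable def rewMax (v : R → ℝ) (PP : Set (RMat R X)) (x' : X) (P : RMat R X) : ℝ :=
  sSup {c : ℝ | ∃ Q ∈ PP, (∀ x ∈ optArms v P, ∀ r, Q r x = P r x) ∧ c = rewOf v Q x'}

/-- The set `X̃_d(P)` of deceitful arms. -/
def deceitArms (v : R → ℝ) (PP : Set (RMat R X)) (P : RMat R X) : Set X :=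
  {x | x ∈ subArms v P ∧ rewStar v P < rewMax v PP x P}

/-- The conic hull `𝒦 = cone(𝒫)`. -/
def coneP (PP : Set (RMat R X)) : Set (RMat R X) :=
  {Q | ∃ θ : ℝ, 0 ≤ θ ∧ ∃ Q' ∈ PP, Q = θ • Q'}

/-- The dual cone `𝒦*`. -/
def dualConeP (PP : Set (RMat R X)) : Set (RMat R X) :=
  {l | ∀ Q ∈ coneP PP, 0 ≤ ∑ x : X, ∑ r : R, l r x * Q r x}

/-- Extended-real logarithm (with `elog t = ⊥` for `t ≤ 0`). -/
noncomputable def elog (t : ℝ) : EReal := if 0 < t then ((Real.log t : ℝ) : EReal) else ⊥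

/-- The dual function `Dual(η, x', Q; μ)` for `μ = (α, β, λ)`. -/
noncomputable def dualFn (v : R → ℝ) (η : X → ℝ) (x' : X) (Q : RMat R X)
    (α β : ℝ) (l : RMat R X) : EReal :=
  if ∀ x ∈ subFinset v Q, ∀ r : R,
      0 ≤ η x - l r x - β - α * v r * (if x = x' then 1 else 0) then
    (∑ x ∈ subFinset v Q, ∑ r : R,
      ((η x * Q r x : ℝ) : EReal) *
        elog ((η x - l r x - β - α * v r * (if x = x' then 1 else 0)) / η x)) +
    ((-(∑ x ∈ optFinset v Q, ∑ r : R, l r x * Q r x) + α * rewStar v Q +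
        β * ((subFinset v Q).card : ℝ) : ℝ) : EReal)
  else ⊥

/-- The set `𝒫'` of reward distributions satisfying Assumption 1. -/
def PPrime (v : R → ℝ) (PP : Set (RMat R X)) : Set (RMat R X) :=
  {P | P ∈ PP ∧ (∃ x₀ : X, optArms v P = {x₀}) ∧
    (∀ x : X, rewMax v PP x P ≠ rewStar v P) ∧ P ∈ relIntIn POmega PP}

/-- The dual-test function `Dualbar(η, x', Q; μ) = max_{ρ ≥ 0} Dual(η, x', Q; ρ·μ)`. -/
noncomputable def dualTest (v : R → ℝ) (η : X → ℝ) (x' : X) (Q : RMat R X)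
    (μ : ℝ × ℝ × RMat R X) : EReal :=
  sSup {d : EReal | ∃ ρ : ℝ, 0 ≤ ρ ∧ d = dualFn v η x' Q (ρ * μ.1) (ρ * μ.2.1) (ρ • μ.2.2)}

end Core

end Bandit

namespace Bandit

open Topology

/-- The contribution `p log (p / q) - p + q` of a single point to the information distance,
written as a supremum of functions affine in `q`. -/
noncomputable def pointDiv (p q : ℝ) : ENNReal :=
  ⨆ s : ℝ, ENNReal.ofReal (p * s - q * (Real.exp s - 1))

theorem pointDiv_zero_left {q : ℝ} (hq : 0 ≤ q) : pointDiv 0 q = ENNReal.ofReal q := by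
  refine le_antisymm (iSup_le fun s => ENNReal.ofReal_le_ofReal ?_) ?_
  · nlinarith [mul_nonneg hq (Real.exp_pos s).le]
  · have h : Tendsto (fun s : ℝ => ENNReal.ofReal (0 * s - q * (Real.exp s - 1))) atBot
        (𝓝 (ENNReal.ofReal q)) := by
      refine ENNReal.tendsto_ofReal ?_
      have := (Real.tendsto_exp_atBot.sub_const 1).const_mul (-q)
      refine (this.congr fun s => by ring).trans_eq (by simp)
    exact le_of_tendsto h (Eventually.of_forall fun s =>
      le_iSup (fun s : ℝ => ENNReal.ofReal (0 * s - q * (Real.exp s - 1))) s)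

theorem pointDiv_zero_right {p : ℝ} (hp : 0 < p) : pointDiv p 0 = ⊤ := by
  have h : Tendsto (fun s : ℝ => ENNReal.ofReal (p * s - 0 * (Real.exp s - 1))) atTop
      (𝓝 ⊤) := by
    refine ENNReal.tendsto_ofReal_atTop.comp ?_
    simpa using tendsto_id.const_mul_atTop hp
  exact top_le_iff.1 (le_of_tendsto h (Eventually.of_forall fun s =>
    le_iSup (fun s : ℝ => ENNReal.ofReal (p * s - 0 * (Real.exp s - 1))) s))

theorem pointDiv_of_pos {p q : ℝ} (hp : 0 < p) (hq : 0 < q) :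
    pointDiv p q = ENNReal.ofReal (p * Real.log (p / q) - p + q) := by
  have he : q * Real.exp (Real.log (p / q)) = p := by
    rw [Real.exp_log (div_pos hp hq)]; field_simp
  refine le_antisymm (iSup_le fun s => ENNReal.ofReal_le_ofReal ?_) ?_
  · have h1 := mul_le_mul_of_nonneg_left (Real.add_one_le_exp (s - Real.log (p / q))) hp.le
    have h2 : p * Real.exp (s - Real.log (p / q)) = q * Real.exp s := by
      nth_rewrite 1 [← he]
      rw [mul_assoc, ← Real.exp_add]
      congr 2
      ring
    linarith
  · refine le_trans (ENNReal.ofReal_le_ofReal ?_)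
      (le_iSup (fun s : ℝ => ENNReal.ofReal (p * s - q * (Real.exp s - 1))) (Real.log (p / q)))
    linarith

theorem pointDiv_eq_ofReal {p q : ℝ} (hp : 0 ≤ p) (hq : 0 ≤ q) (h : q = 0 → p = 0) :
    pointDiv p q = ENNReal.ofReal (p * Real.log (p / q) - p + q) := by
  rcases hp.eq_or_lt with rfl | hp
  · simp [pointDiv_zero_left hq]
  · exact pointDiv_of_pos hp (hq.lt_of_ne fun h0 => hp.ne' (h h0.symm))

theorem mul_log_div_sub_add_nonneg {p q : ℝ} (hp : 0 ≤ p) (hq : 0 ≤ q) (h : q = 0 → p = 0) :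
    0 ≤ p * Real.log (p / q) - p + q := by
  rcases hp.eq_or_lt with rfl | hp
  · simpa using hq
  · have hq : 0 < q := hq.lt_of_ne fun h0 => hp.ne' (h h0.symm)
    have h1 := mul_le_mul_of_nonneg_left (Real.one_sub_inv_le_log_of_pos (div_pos hp hq)) hp.le
    have h2 : p * (1 - (p / q)⁻¹) = p - q := by field_simp
    linarith

theorem lowerSemicontinuous_pointDiv (p : ℝ) : LowerSemicontinuous (pointDiv p) :=
  lowerSemicontinuous_iSup fun s => Continuous.lowerSemicontinuous <|
    ENNReal.continuous_ofReal.comp (by fun_prop)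

theorem pointDiv_convex_comb_le {p q₀ q₁ a b : ℝ} (ha : 0 ≤ a) (hb : 0 ≤ b) (hab : a + b = 1) :
    pointDiv p (a * q₀ + b * q₁) ≤
      ENNReal.ofReal a * pointDiv p q₀ + ENNReal.ofReal b * pointDiv p q₁ := by
  refine iSup_le fun s => ?_
  have h : p * s - (a * q₀ + b * q₁) * (Real.exp s - 1) =
      a * (p * s - q₀ * (Real.exp s - 1)) + b * (p * s - q₁ * (Real.exp s - 1)) := by
    linear_combination (-(p * s)) * hab
  rw [h]
  refine ENNReal.ofReal_add_le.trans ?_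
  rw [ENNReal.ofReal_mul ha, ENNReal.ofReal_mul hb]
  gcongr
  · exact le_iSup (fun s : ℝ => ENNReal.ofReal (p * s - q₀ * (Real.exp s - 1))) s
  · exact le_iSup (fun s : ℝ => ENNReal.ofReal (p * s - q₁ * (Real.exp s - 1))) s

theorem coe_ennreal_finset_sum {ι : Type*} (s : Finset ι) (f : ι → ENNReal) :
    ((∑ i ∈ s, f i : ENNReal) : EReal) = ∑ i ∈ s, (f i : EReal) :=
  map_sum (⟨⟨(fun x : ENNReal => (x : EReal)), rfl⟩, EReal.coe_ennreal_add⟩ : ENNReal →+ EReal) f s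

theorem infoDiv_eq_sum_pointDiv {α : Type*} [Fintype α] {M' M : α → ℝ}
    (hM' : ∀ a, 0 ≤ M' a) (hM : ∀ a, 0 ≤ M a) :
    infoDiv M' M = ((∑ a, pointDiv (M' a) (M a) : ENNReal) : EReal) := by
  unfold infoDiv
  split_ifs with h
  · have hn : ∀ a, 0 ≤ M' a * Real.log (M' a / M a) - M' a + M a := fun a =>
      mul_log_div_sub_add_nonneg (hM' a) (hM a) (h a)
    rw [Finset.sum_congr rfl fun a _ => pointDiv_eq_ofReal (hM' a) (hM a) (h a),
      ← ENNReal.ofReal_sum_of_nonneg fun a _ => hn a, EReal.coe_ennreal_ofReal,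
      max_eq_left (Finset.sum_nonneg fun a _ => hn a)]
  · push Not at h
    obtain ⟨a, ha, ha'⟩ := h
    rw [(ENNReal.sum_eq_top).2 ⟨a, Finset.mem_univ a, ?_⟩, EReal.coe_ennreal_top]
    rw [ha]
    exact pointDiv_zero_right ((hM' a).lt_of_ne' ha')

theorem rewOf_convex_comb {R X : Type*} [Fintype R] (v : R → ℝ) (Q₀ Q₁ : RMat R X) (a b : ℝ)
    (x : X) :
    rewOf v (a • Q₀ + b • Q₁) x = a * rewOf v Q₀ x + b * rewOf v Q₁ x := by
  simp only [rewOf, Finset.mul_sum, ← Finset.sum_add_distrib]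
  refine Finset.sum_congr rfl fun r _ => ?_
  simp only [Pi.add_apply, Pi.smul_apply, smul_eq_mul]
  ring

theorem continuous_rewOf {R X : Type*} [Fintype R] (v : R → ℝ) (x : X) :
    Continuous fun Q : RMat R X => rewOf v Q x := by
  unfold rewOf
  fun_prop

section Objective

variable {R X : Type*} [Fintype R] [Fintype X] [Nonempty X]

/-- The objective `distObj` with values in `ENNReal`. -/
noncomputable def distObjENN (v : R → ℝ) (η : X → ℝ) (P Q : RMat R X) : ENNReal :=
  ∑ x ∈ subFinset v P, ENNReal.ofReal (η x) * ∑ r, pointDiv (P r x) (Q r x)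

theorem distObj_eq_coe {v : R → ℝ} {η : X → ℝ} (hη : ∀ x, 0 ≤ η x) {P Q : RMat R X}
    (hP : P ∈ POmega) (hQ : Q ∈ POmega) :
    distObj v η P Q = (distObjENN v η P Q : EReal) := by
  unfold distObj distObjENN
  rw [coe_ennreal_finset_sum]
  refine Finset.sum_congr rfl fun x _ => ?_
  rw [EReal.coe_ennreal_mul, EReal.coe_ennreal_ofReal, max_eq_left (hη x),
    infoDiv_eq_sum_pointDiv (fun r => hP.1 r x) (fun r => hQ.1 r x)]

theorem lowerSemicontinuous_distObjENN (v : R → ℝ) (η : X → ℝ) (P : RMat R X) :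
    LowerSemicontinuous (distObjENN v η P) := by
  refine lowerSemicontinuous_sum fun x _ => ?_
  refine (ENNReal.continuous_const_mul ENNReal.ofReal_ne_top).comp_lowerSemicontinuous
    (lowerSemicontinuous_sum fun r _ => ?_) fun a b h => mul_le_mul_right h _
  exact (lowerSemicontinuous_pointDiv _).comp (by fun_prop : Continuous fun Q : RMat R X => Q r x)

theorem distObjENN_convex_comb_le (v : R → ℝ) (η : X → ℝ) (P Q₀ Q₁ : RMat R X) {a b : ℝ}
    (ha : 0 ≤ a) (hb : 0 ≤ b) (hab : a + b = 1) :
    distObjENN v η P (a • Q₀ + b • Q₁) ≤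
      ENNReal.ofReal a * distObjENN v η P Q₀ + ENNReal.ofReal b * distObjENN v η P Q₁ := by
  unfold distObjENN
  simp only [Finset.mul_sum, ← Finset.sum_add_distrib]
  refine Finset.sum_le_sum fun x _ => Finset.sum_le_sum fun r _ => ?_
  refine (mul_le_mul_right (pointDiv_convex_comb_le (p := P r x) (q₀ := Q₀ r x) (q₁ := Q₁ r x)
    ha hb hab) (ENNReal.ofReal (η x))).trans_eq ?_
  ring

theorem distObjENN_ne_top {v : R → ℝ} {η : X → ℝ} {P Q : RMat R X} (hP : P ∈ POmega)
    (hQ : Q ∈ POmega) (h : ∀ r x, Q r x = 0 → P r x = 0) : distObjENN v η P Q ≠ ⊤ := by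
  refine ENNReal.sum_ne_top.2 fun x _ => ENNReal.mul_ne_top ENNReal.ofReal_ne_top
    (ENNReal.sum_ne_top.2 fun r _ => ?_)
  rw [pointDiv_eq_ofReal (hP.1 r x) (hQ.1 r x) (h r x)]
  exact ENNReal.ofReal_ne_top

theorem rewOf_le_rewStar (v : R → ℝ) (Q : RMat R X) (x : X) : rewOf v Q x ≤ rewStar v Q :=
  Finset.le_sup' _ (Finset.mem_univ x)

theorem optArms_nonempty (v : R → ℝ) (Q : RMat R X) : (optArms v Q).Nonempty := by
  obtain ⟨x, -, hx⟩ := Finset.exists_mem_eq_sup' Finset.univ_nonempty (rewOf v Q)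
  exact ⟨x, hx.symm⟩

/-- The distributions in `PP` that agree with `P` on the optimal arms of `P`. -/
def agreeSet (v : R → ℝ) (PP : Set (RMat R X)) (P : RMat R X) : Set (RMat R X) :=
  {Q | Q ∈ PP ∧ ∀ x ∈ optArms v P, ∀ r, Q r x = P r x}

theorem mem_deceitSet_iff {v : R → ℝ} {PP : Set (RMat R X)} {x' : X} {P Q : RMat R X} :
    Q ∈ DeceitSet v PP x' P ↔ Q ∈ agreeSet v PP P ∧ rewStar v P < rewOf v Q x' := by
  have key : (∀ x ∈ optArms v P, ∀ r, Q r x = P r x) →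
      ∀ x ∈ optArms v P, rewOf v Q x = rewStar v P := fun h x hx =>
    (Finset.sum_congr rfl fun r _ => by rw [h x hx r]).trans hx
  constructor
  · rintro ⟨h1, h2, h3⟩
    obtain ⟨x, hx⟩ := optArms_nonempty v P
    exact ⟨⟨h1, h2⟩, key h2 x hx ▸ h3 x hx⟩
  · rintro ⟨⟨h1, h2⟩, h3⟩
    exact ⟨h1, h2, fun x hx => (key h2 x hx).trans_lt h3⟩

theorem convex_agreeSet (v : R → ℝ) {PP : Set (RMat R X)} (hconv : Convex ℝ PP) (P : RMat R X) :
    Convex ℝ (agreeSet v PP P) := by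
  rintro Q₀ ⟨h₀, e₀⟩ Q₁ ⟨h₁, e₁⟩ a b ha hb hab
  refine ⟨hconv h₀ h₁ ha hb hab, fun x hx r => ?_⟩
  simp only [Pi.add_apply, Pi.smul_apply, smul_eq_mul, e₀ x hx r, e₁ x hx r]
  rw [← add_mul, hab, one_mul]

theorem isCompact_agreeSet (v : R → ℝ) {PP : Set (RMat R X)} (hcomp : IsCompact PP)
    (P : RMat R X) : IsCompact (agreeSet v PP P) := by
  refine hcomp.inter_right (t := {Q | ∀ x ∈ optArms v P, ∀ r, Q r x = P r x}) ?_
  simp only [Set.ofPred_forall]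
  exact isClosed_iInter fun x => isClosed_iInter fun _ => isClosed_iInter fun r =>
    isClosed_eq (by fun_prop) continuous_const

/-- A deceitful arm admits a deceitful distribution at finite distance. -/
theorem exists_mem_deceitSet_distObjENN_ne_top {v : R → ℝ} {PP : Set (RMat R X)}
    (hsub : PP ⊆ POmega) (hconv : Convex ℝ PP) {P : RMat R X} (hP : P ∈ PP) {x' : X}
    (hx' : x' ∈ deceitArms v PP P) (η : X → ℝ) :
    ∃ Q ∈ DeceitSet v PP x' P, distObjENN v η P Q ≠ ⊤ := by
  have hPA : P ∈ agreeSet v PP P := ⟨hP, fun _ _ _ => rfl⟩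
  have hne : {c : ℝ | ∃ Q ∈ PP, (∀ x ∈ optArms v P, ∀ r, Q r x = P r x) ∧
      c = rewOf v Q x'}.Nonempty := ⟨_, P, hP, hPA.2, rfl⟩
  obtain ⟨_, ⟨Q, hQ, hQe, rfl⟩, hlt⟩ := exists_lt_of_lt_csSup hne hx'.2
  have hb := rewOf_le_rewStar v P x'
  set A := rewOf v Q x'
  set B := rewOf v P x'
  have hd : 0 < A - B := by linarith
  obtain ⟨t, ht⟩ : ∃ t, t = (A - rewStar v P) / (2 * (A - B)) := ⟨_, rfl⟩
  have ht0 : 0 < t := ht ▸ div_pos (by linarith) (by linarith)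
  have ht1 : t < 1 := by
    rw [ht, div_lt_one (by linarith)]
    linarith
  have htm : t * (A - B) = (A - rewStar v P) / 2 := by
    rw [ht]
    field_simp
  have hmem := convex_agreeSet v hconv P ⟨hQ, hQe⟩ hPA (sub_pos.2 ht1).le ht0.le
    (sub_add_cancel 1 t)
  refine ⟨(1 - t) • Q + t • P, mem_deceitSet_iff.2 ⟨hmem, ?_⟩,
    distObjENN_ne_top (hsub hP) (hsub hmem.1) fun r x h => ?_⟩
  · rw [rewOf_convex_comb]
    change _ < (1 - t) * A + t * B
    linarith
  · simp only [Pi.add_apply, Pi.smul_apply, smul_eq_mul] at h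
    have h1 := mul_nonneg (sub_pos.2 ht1).le ((hsub hQ).1 r x)
    have h2 := (hsub hP).1 r x
    have h3 : t * P r x = 0 := le_antisymm (by linarith) (mul_nonneg ht0.le h2)
    exact (mul_eq_zero.1 h3).resolve_left ht0.ne'

end Objective

/-- Proposition: distance function for deceitful arms.
For `P ∈ 𝒫`, a deceitful arm `x' ∈ X̃_d(P)` and a nonnegative exploration rate `η ≥ 0`,
the distance `Dist(η, x', P)` is finite and is the attained minimum of
`Σ_{x∈X̃(P)} η(x)·I(P(x),Q(x))` over all `Q ∈ 𝒫` with `Q(x*(P)) = P(x*(P))` and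
`Σ_r r·Q(r,x') ≥ Rew*(P)`. -/
theorem dist_deceitful_attained
    {R X : Type*} [Fintype R] [Fintype X] [Nonempty X]
    (v : R → ℝ) (hv : ∀ r, 0 ≤ v r)
    (PP : Set (RMat R X)) (hsub : PP ⊆ POmega) (hconv : Convex ℝ PP)
    (hcomp : IsCompact PP) (hne : (relIntIn POmega PP).Nonempty)
    (P : RMat R X) (hP : P ∈ PP)
    (x' : X) (hx' : x' ∈ deceitArms v PP P)
    (η : X → ℝ) (hη : ∀ x, 0 ≤ η x) :
    DistFn v PP η x' P ≠ ⊤ ∧ DistFn v PP η x' P ≠ ⊥ ∧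
    IsLeast {c : EReal | ∃ Q, Q ∈ PP ∧ (∀ x ∈ optArms v P, ∀ r, Q r x = P r x) ∧
        rewStar v P ≤ rewOf v Q x' ∧ c = distObj v η P Q}
      (DistFn v PP η x' P) := by
  obtain ⟨Q₁, hQ₁, hfin⟩ := exists_mem_deceitSet_distObjENN_ne_top hsub hconv hP hx' η
  have hQ₁' := mem_deceitSet_iff.1 hQ₁
  have hcoe : ∀ {Q}, Q ∈ PP → distObj v η P Q = (distObjENN v η P Q : EReal) := fun hQ =>
    distObj_eq_coe hη (hsub hP) (hsub hQ)
  have hK : IsCompact (agreeSet v PP P ∩ {Q | rewStar v P ≤ rewOf v Q x'}) :=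
    (isCompact_agreeSet v hcomp P).inter_right
      (isClosed_le continuous_const (continuous_rewOf v x'))
  have hne_K : (agreeSet v PP P ∩ {Q | rewStar v P ≤ rewOf v Q x'}).Nonempty :=
    ⟨Q₁, hQ₁'.1, hQ₁'.2.le⟩
  obtain ⟨Q₀, ⟨hQ₀, hQ₀r⟩, hmin⟩ :=
    ((lowerSemicontinuous_distObjENN v η P).lowerSemicontinuousOn _).exists_isMinOn hne_K hK
  have hle : ∀ Q ∈ agreeSet v PP P, rewStar v P ≤ rewOf v Q x' →
      distObjENN v η P Q₀ ≤ distObjENN v η P Q := fun Q hQ hr => hmin ⟨hQ, hr⟩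
  have hdist : DistFn v PP η x' P = (distObjENN v η P Q₀ : EReal) := by
    refine le_antisymm ?_ (le_sInf ?_)
    · have hlim : Tendsto (fun t : ℝ => ((distObjENN v η P Q₀ +
          ENNReal.ofReal t * distObjENN v η P Q₁ : ENNReal) : EReal)) (𝓝[>] 0)
          (𝓝 (distObjENN v η P Q₀ : EReal)) := by
        refine (continuous_coe_ennreal_ereal.tendsto _).comp ?_
        have h0 : Tendsto (fun t : ℝ => ENNReal.ofReal t) (𝓝[>] 0) (𝓝 0) := by
          simpa using (ENNReal.continuous_ofReal.tendsto 0).mono_left nhdsWithin_le_nhds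
        simpa using tendsto_const_nhds.add (ENNReal.Tendsto.mul_const h0 (Or.inr hfin))
      refine ge_of_tendsto hlim ?_
      filter_upwards [Ioo_mem_nhdsGT (zero_lt_one' ℝ)] with t ht
      have hmem := convex_agreeSet v hconv P hQ₀ hQ₁'.1 (sub_pos.2 ht.2).le ht.1.le
        (sub_add_cancel 1 t)
      have hdec : (1 - t) • Q₀ + t • Q₁ ∈ DeceitSet v PP x' P := by
        refine mem_deceitSet_iff.2 ⟨hmem, ?_⟩
        rw [rewOf_convex_comb]
        have h1 := mul_le_mul_of_nonneg_left hQ₀r.out (sub_pos.2 ht.2).le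
        have h2 := mul_lt_mul_of_pos_left hQ₁'.2 ht.1
        linarith
      refine (sInf_le (Set.mem_image_of_mem _ hdec)).trans ?_
      rw [hcoe hmem.1]
      refine EReal.coe_ennreal_le_coe_ennreal_iff.2 ?_
      refine (distObjENN_convex_comb_le v η P Q₀ Q₁ (sub_pos.2 ht.2).le ht.1.le
        (sub_add_cancel 1 t)).trans ?_
      gcongr
      exact mul_le_of_le_one_left' (ENNReal.ofReal_le_one.2 (by linarith [ht.1]))
    · rintro _ ⟨Q, hQ, rfl⟩
      have hQ' := mem_deceitSet_iff.1 hQ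
      rw [hcoe hQ.1]
      exact EReal.coe_ennreal_le_coe_ennreal_iff.2 (hle Q hQ'.1 hQ'.2.le)
  rw [hdist]
  refine ⟨?_, EReal.coe_ennreal_ne_bot _, ⟨Q₀, hQ₀.1, hQ₀.2, hQ₀r, (hcoe hQ₀.1).symm⟩, ?_⟩
  · rw [Ne, EReal.coe_ennreal_eq_top_iff]
    exact ne_top_of_le_ne_top hfin (hle Q₁ hQ₁'.1 hQ₁'.2.le)
  · rintro _ ⟨Q, hQ, hQe, hr, rfl⟩
    rw [hcoe hQ]
    exact EReal.coe_ennreal_le_coe_ennreal_iff.2 (hle Q ⟨hQ, hQe⟩ hr)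

end Bandit
end

section
/- Weak and strong duality for the distance function: (i) For every reward distribution P ∈ 𝒫_Ω, every arm x′ ∈ X, every η ≥ 0, and every dual vector μ = (α,β,λ) ∈ ℝ_+ × ℝ × 𝒦*, one has Dual(η,x′,P;μ) ≤ Dist(η,x′,P). (ii) For every P ∈ 𝒫 and every deceitful arm x′ ∈ X̃_d(P), Dist(η,x′,P) = sup { Dual(η,x′,P;μ) : μ ∈ ℝ_+ × ℝ × 𝒦* }. -/
open scoped BigOperators Classical
open Filter

namespace Bandit

/-- The pointwise contribution `a (p log (p / q) - p + q)` to the weighted information distance. -/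
noncomputable def klTerm (a p q : ℝ) : ℝ := a * (p * Real.log (p / q) - p + q)

lemma klTerm_nonneg {a p q : ℝ} (ha : 0 ≤ a) (hp : 0 ≤ p) (hq : 0 ≤ q)
    (hpq : 0 < a * p → 0 < q) : 0 ≤ klTerm a p q := by
  unfold klTerm
  rcases ha.eq_or_lt with rfl | ha'
  · simp
  rcases hp.eq_or_lt with rfl | hp'
  · simpa using mul_nonneg ha hq
  have hq' := hpq (mul_pos ha' hp')
  have h := Real.log_le_sub_one_of_pos (div_pos hq' hp')
  rw [← inv_div, Real.log_inv]
  have h2 : p * Real.log (q / p) ≤ q - p := by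
    calc p * Real.log (q / p) ≤ p * (q / p - 1) := by gcongr
      _ = q - p := by field_simp
  apply mul_nonneg ha
  linarith

lemma convexOn_klTerm {a p : ℝ} (ha : 0 ≤ a) (hp : 0 ≤ p) :
    ConvexOn ℝ {q : ℝ | 0 ≤ q ∧ (0 < a * p → 0 < q)} (klTerm a p) := by
  rcases (mul_nonneg ha hp).eq_or_lt with h | h
  · have hS : {q : ℝ | 0 ≤ q ∧ (0 < a * p → 0 < q)} = Set.Ici 0 := by
      ext q; simp [← h]
    rw [hS]
    have hf : klTerm a p = fun q => a * q + -(a * p) := by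
      funext q
      unfold klTerm
      linear_combination (-Real.log (p / q)) * h
    rw [hf]
    refine ⟨convex_Ici 0, fun x _ y _ s t _ _ hst => le_of_eq ?_⟩
    simp only [smul_eq_mul]
    linear_combination (a * p) * hst
  · have hp' : 0 < p := pos_of_mul_pos_right h ha
    refine ⟨?_, ?_⟩
    · have hS : {q : ℝ | 0 ≤ q ∧ (0 < a * p → 0 < q)} = Set.Ioi 0 := by
        ext q; simp only [h, Set.mem_ofPred_eq, forall_const, Set.mem_Ioi]
        exact ⟨fun h => h.2, fun h => ⟨h.le, h⟩⟩
      rw [hS]; exact convex_Ioi 0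
    · rintro x ⟨-, hx⟩ y ⟨-, hy⟩ s t hs ht hst
      have hx := hx h
      have hy := hy h
      have hxy : 0 < s • x + t • y := convex_Ioi (0 : ℝ) hx hy hs ht hst
      have hc := strictConcaveOn_log_Ioi.concaveOn.2 hx hy hs ht hst
      unfold klTerm
      rw [Real.log_div hp'.ne' hx.ne', Real.log_div hp'.ne' hy.ne',
        Real.log_div hp'.ne' hxy.ne']
      simp only [smul_eq_mul] at hc ⊢
      have := mul_le_mul_of_nonneg_left hc h.le
      have ht' : t = 1 - s := by linarith
      subst ht'
      linarith

lemma continuousAt_klTerm {a p q : ℝ} (hp : 0 ≤ p) (ha : 0 ≤ a)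
    (hpq : 0 < a * p → 0 < q) : ContinuousAt (klTerm a p) q := by
  rcases (mul_nonneg ha hp).eq_or_lt with h | h
  · have hf : klTerm a p = fun q => a * q + -(a * p) := by
      funext q
      unfold klTerm
      linear_combination (-Real.log (p / q)) * h
    rw [hf]; fun_prop
  · have hq := hpq h
    have hp' : 0 < p := pos_of_mul_pos_right h ha
    unfold klTerm
    have : p / q ≠ 0 := (div_pos hp' hq).ne'
    fun_prop (disch := first | assumption | exact hq.ne')

/-- A bound on `klTerm a p` keeps its last argument away from zero. -/
lemma exists_pos_le_of_klTerm_le {a p : ℝ} (ha : 0 < a) (hp : 0 < p) (M : ℝ) :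
    ∃ δ > 0, ∀ q, 0 < q → klTerm a p q ≤ M → δ ≤ q := by
  refine ⟨p * Real.exp (-((M / a + p) / p)), by positivity, fun q hq h => ?_⟩
  have h1 : p * Real.log (p / q) - p + q ≤ M / a := by
    rw [le_div_iff₀ ha]; unfold klTerm at h; linarith
  have h2 : Real.log (p / q) ≤ (M / a + p) / p := by
    rw [le_div_iff₀ hp]; linarith
  rw [← inv_div, Real.log_inv] at h2
  have h3 : Real.exp (-((M / a + p) / p)) ≤ q / p := by
    rw [← Real.le_log_iff_exp_le (div_pos hq hp)]; linarith
  rw [le_div_iff₀ hp] at h3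
  linarith

/-- A lower bound on `q ↦ b log (p / q) + s q` over positive `q` forces `s` to be nonnegative,
and positive when `b` is. -/
lemma slope_nonneg_of_log_bound {b p s C : ℝ} (hb : 0 ≤ b) (hp : 0 ≤ p) (hbp : 0 < b → 0 < p)
    (h : ∀ q, 0 < q → C ≤ b * Real.log (p / q) + s * q) : 0 ≤ s ∧ (0 < b → 0 < s) := by
  have hs : 0 ≤ s := by
    by_contra! hs
    set q := max (max p 1) ((C - 1) / s) with hq
    have hq1 : 1 ≤ q := le_trans (le_max_right p 1) (le_max_left _ _)
    have hqp : p ≤ q := le_trans (le_max_left p 1) (le_max_left _ _)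
    have hqC : (C - 1) / s ≤ q := le_max_right _ _
    have hq0 : 0 < q := by linarith
    have h1 := h q hq0
    have h2 : Real.log (p / q) ≤ 0 :=
      Real.log_nonpos (by positivity) ((div_le_one hq0).2 hqp)
    have h3 : s * q ≤ C - 1 := by
      rw [div_le_iff_of_neg hs] at hqC; linarith
    have h4 := mul_nonpos_of_nonneg_of_nonpos hb h2
    linarith
  refine ⟨hs, fun hb' => hs.lt_of_ne ?_⟩
  rintro rfl
  have hp' := hbp hb'
  have h1 := h (p * Real.exp ((1 - C) / b)) (by positivity)
  have h2 : p / (p * Real.exp ((1 - C) / b)) = Real.exp (-((1 - C) / b)) := by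
    rw [Real.exp_neg]; field_simp
  rw [h2, Real.log_exp] at h1
  have h3 : b * ((1 - C) / b) = 1 - C := by field_simp
  linarith

/-- The pointwise Fenchel inequality behind weak duality. -/
lemma mul_log_le_klTerm {a p q s : ℝ} (ha : 0 < a) (hp : 0 < p) (hq : 0 < q) (hs : 0 < s) :
    a * p * Real.log (s / a) ≤ klTerm a p q + (s - a) * q := by
  have h := Real.log_le_sub_one_of_pos (div_pos (mul_pos hs hq) (mul_pos ha hp))
  have h1 : Real.log (s * q / (a * p)) = Real.log (s / a) - Real.log (p / q) := by
    rw [← Real.log_div (by positivity) (by positivity)]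
    congr 1
    field_simp
  rw [h1] at h
  have h2 := mul_le_mul_of_nonneg_left h (mul_pos ha hp).le
  have h3 : a * p * (s * q / (a * p) - 1) = s * q - a * p := by field_simp
  unfold klTerm
  linarith

lemma coe_finset_sum_eReal {ι : Type*} (t : Finset ι) (f : ι → ℝ) :
    ((∑ i ∈ t, f i : ℝ) : EReal) = ∑ i ∈ t, (f i : EReal) := by
  induction t using Finset.induction_on with
  | empty => simp
  | insert i t hi ih => rw [Finset.sum_insert hi, Finset.sum_insert hi, EReal.coe_add, ih]

lemma sum_mul_elog_le {R : Type*} [Fintype R] {a : ℝ} (ha : 0 ≤ a) {p q s : R → ℝ}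
    (hp : ∀ r, 0 ≤ p r) (hq : ∀ r, 0 ≤ q r) (hs : ∀ r, 0 ≤ s r) :
    ∑ r, ((a * p r : ℝ) : EReal) * elog (s r / a) ≤
      (a : EReal) * infoDiv p q + ((∑ r, (s r - a) * q r : ℝ) : EReal) := by
  rcases ha.eq_or_lt with rfl | ha'
  · simp only [zero_mul, EReal.coe_zero, Finset.sum_const_zero, sub_zero, zero_add]
    exact_mod_cast Finset.sum_nonneg fun r _ => mul_nonneg (hs r) (hq r)
  unfold infoDiv
  split_ifs with hac
  · rw [← EReal.coe_mul, ← EReal.coe_add, Finset.mul_sum, ← Finset.sum_add_distrib,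
      coe_finset_sum_eReal]
    refine Finset.sum_le_sum fun r _ => ?_
    change _ ≤ ((klTerm a (p r) (q r) + (s r - a) * q r : ℝ) : EReal)
    rcases (hp r).eq_or_lt with h0 | hpr
    · have : klTerm a (p r) (q r) + (s r - a) * q r = s r * q r := by
        unfold klTerm; rw [← h0]; ring
      rw [this, ← h0]
      simpa using EReal.coe_nonneg.2 (mul_nonneg (hs r) (hq r))
    have hqr : 0 < q r := (hq r).lt_of_ne fun h => hpr.ne' (hac r h.symm)
    unfold elog
    split_ifs with hsr
    · have hsr' : 0 < s r := by
        have := mul_pos hsr ha'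
        rwa [div_mul_cancel₀ _ ha'.ne'] at this
      rw [← EReal.coe_mul]
      exact EReal.coe_le_coe_iff.2 (mul_log_le_klTerm ha' hpr hqr hsr')
    · rw [EReal.coe_mul_bot_of_pos (mul_pos ha' hpr)]
      exact bot_le
  · rw [EReal.coe_mul_top_of_pos ha', EReal.top_add_coe]
    exact le_top

lemma rewOf_congr {R X : Type*} [Fintype R] {v : R → ℝ} {P Q : RMat R X} {x : X}
    (h : ∀ r, Q r x = P r x) :
    rewOf v Q x = rewOf v P x := by
  simp [rewOf, h]

lemma rewOf_add_smul {R X : Type*} [Fintype R]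
    (v : R → ℝ) (P Q : RMat R X) (x : X) (s t : ℝ) :
    rewOf v (s • P + t • Q) x = s * rewOf v P x + t * rewOf v Q x := by
  simp only [rewOf, Finset.mul_sum, ← Finset.sum_add_distrib]
  refine Finset.sum_congr rfl fun r _ => ?_
  simp only [Pi.add_apply, Pi.smul_apply, smul_eq_mul]
  ring

lemma convex_coneP {R X : Type*} {PP : Set (RMat R X)} (hconv : Convex ℝ PP) :
    Convex ℝ (coneP PP) := by
  rintro _ ⟨θ, hθ, q, hq, rfl⟩ _ ⟨θ', hθ', q', hq', rfl⟩ s t hs ht -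
  obtain ⟨z, hz, h⟩ :=
    hconv.exists_mem_add_smul_eq hq hq' (mul_nonneg hs hθ) (mul_nonneg ht hθ')
  exact ⟨_, add_nonneg (mul_nonneg hs hθ) (mul_nonneg ht hθ'), z, hz, by
    rw [h, smul_smul, smul_smul]⟩

lemma exists_pairing_eq {R X : Type*} [Fintype R] [Fintype X]
    (φ : RMat R X →ₗ[ℝ] ℝ) :
    ∃ l : RMat R X, ∀ W, φ W = ∑ x, ∑ r, l r x * W r x := by
  refine ⟨fun r x => φ (Pi.single r (Pi.single x 1)), fun W => ?_⟩
  have hW : W = ∑ r, ∑ x, W r x • (Pi.single r (Pi.single x 1) : RMat R X) := by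
    funext r x
    simp only [Finset.sum_apply, Pi.smul_apply, smul_eq_mul]
    rw [Finset.sum_eq_single r, Finset.sum_eq_single x]
    · simp
    · intro y _ hy
      simp [hy.symm]
    · simp
    · intro r' _ hr'
      simp [hr'.symm]
    · simp
  conv_lhs => rw [hW]
  rw [Finset.sum_comm]
  simp only [map_sum, map_smul, smul_eq_mul, mul_comm]

section Duality

variable {R X : Type*} [Fintype R] [Fintype X] [Nonempty X]

lemma exists_mem_optArms (v : R → ℝ) (P : RMat R X) : ∃ x, x ∈ optArms v P := by
  obtain ⟨x, -, hx⟩ := Finset.exists_mem_eq_sup' Finset.univ_nonempty (rewOf v P)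
  exact ⟨x, hx.symm⟩

lemma mem_optFinset {v : R → ℝ} {P : RMat R X} {x : X} :
    x ∈ optFinset v P ↔ x ∈ optArms v P := by
  simp [optFinset, optArms]

lemma mem_subFinset {v : R → ℝ} {P : RMat R X} {x : X} :
    x ∈ subFinset v P ↔ x ∈ subArms v P := by
  simp [subFinset, subArms]

lemma sum_optFinset_add_sum_subFinset (v : R → ℝ) (P : RMat R X) (g : X → ℝ) :
    ∑ x ∈ optFinset v P, g x + ∑ x ∈ subFinset v P, g x = ∑ x, g x :=
  Finset.sum_filter_add_sum_filter_not _ _ _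

/-- The slack minus `η`, summed against `Q` over the suboptimal arms. -/
lemma sum_slack_mul (v : R → ℝ) {P Q : RMat R X} {x' : X}
    (hx' : x' ∈ subFinset v P) (hQP : ∀ x ∈ optArms v P, ∀ r, Q r x = P r x)
    (η : X → ℝ) (α β : ℝ) (l : RMat R X) :
    ∑ x ∈ subFinset v P, ∑ r,
        (η x - l r x - β - α * v r * (if x = x' then 1 else 0) - η x) * Q r x =
      -(∑ x, ∑ r, l r x * Q r x) + (∑ x ∈ optFinset v P, ∑ r, l r x * P r x)
        - β * ∑ x ∈ subFinset v P, ∑ r, Q r x - α * rewOf v Q x' := by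
  have h1 : ∑ x ∈ subFinset v P, ∑ r, α * v r * (if x = x' then 1 else 0) * Q r x
      = α * rewOf v Q x' := by
    rw [Finset.sum_eq_single_of_mem x' hx']
    · simp only [rewOf, Finset.mul_sum, if_true, mul_one, mul_assoc]
    · intro x _ hx
      simp [hx]
  have h2 : ∑ x ∈ optFinset v P, ∑ r, l r x * P r x = ∑ x ∈ optFinset v P, ∑ r, l r x * Q r x :=
    Finset.sum_congr rfl fun x hx => Finset.sum_congr rfl fun r _ => by
      rw [hQP x (mem_optFinset.1 hx)]
  rw [← h1, h2, ← sum_optFinset_add_sum_subFinset v P, Finset.mul_sum]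
  simp only [Finset.mul_sum]
  rw [neg_add_rev, neg_add_cancel_right, ← Finset.sum_neg_distrib,
    ← Finset.sum_sub_distrib, ← Finset.sum_sub_distrib]
  refine Finset.sum_congr rfl fun x _ => ?_
  rw [← Finset.sum_neg_distrib, ← Finset.sum_sub_distrib, ← Finset.sum_sub_distrib]
  refine Finset.sum_congr rfl fun r _ => ?_
  ring

/-- Weak duality. -/
lemma dualFn_le_DistFn {v : R → ℝ} {PP : Set (RMat R X)} (hsub : PP ⊆ POmega) {P : RMat R X}
    (hP : P ∈ POmega) (x' : X) {η : X → ℝ} (hη : ∀ x, 0 ≤ η x) {α : ℝ} (β : ℝ) {l : RMat R X}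
    (hα : 0 ≤ α) (hl : l ∈ dualConeP PP) :
    dualFn v η x' P α β l ≤ DistFn v PP η x' P := by
  refine le_sInf ?_
  rintro _ ⟨Q, ⟨hQ, hQP, hrew⟩, rfl⟩
  obtain ⟨x₀, hx₀⟩ := exists_mem_optArms v P
  have hrew₀ : rewStar v P < rewOf v Q x' := by
    have h := hrew x₀ hx₀
    rwa [rewOf_congr (hQP x₀ hx₀), show rewOf v P x₀ = rewStar v P from hx₀] at h
  have hx' : x' ∈ subFinset v P := by
    rw [mem_subFinset]
    intro h
    exact lt_irrefl _ (hrew x' h)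
  unfold dualFn
  split_ifs with hs
  swap
  · exact bot_le
  have hpair : 0 ≤ ∑ x, ∑ r, l r x * Q r x := hl Q ⟨1, zero_le_one, Q, hQ, (one_smul _ _).symm⟩
  have hmass : ∑ x ∈ subFinset v P, ∑ r, Q r x = ((subFinset v P).card : ℝ) := by
    simp [(hsub hQ).2]
  have hid := sum_slack_mul v hx' hQP η α β l
  rw [hmass] at hid
  have hα' := mul_le_mul_of_nonneg_left hrew₀.le hα
  calc _ ≤ (∑ x ∈ subFinset v P, (((η x : ℝ) : EReal) *
          infoDiv (fun r => P r x) (fun r => Q r x) +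
          ((∑ r, (η x - l r x - β - α * v r * (if x = x' then 1 else 0) - η x) * Q r x : ℝ)
            : EReal))) +
        ((-(∑ x ∈ optFinset v P, ∑ r : R, l r x * P r x) + α * rewStar v P +
          β * ((subFinset v P).card : ℝ) : ℝ) : EReal) := by
        gcongr with x hx
        exact sum_mul_elog_le (hη x) (fun r => hP.1 r x) (fun r => (hsub hQ).1 r x) (hs x hx)
    _ = distObj v η P Q + ((-(∑ x, ∑ r, l r x * Q r x) +
          (α * rewStar v P - α * rewOf v Q x') : ℝ) : EReal) := by
        rw [Finset.sum_add_distrib, ← coe_finset_sum_eReal, hid, add_assoc, ← EReal.coe_add]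
        unfold distObj
        congr 2
        ring
    _ ≤ distObj v η P Q + ((0 : ℝ) : EReal) := by
        gcongr
        linarith
    _ = distObj v η P Q := by simp

/-- The matrices that agree with `P` on its optimal arms, are nonnegative, and give the distance
objective a finite value. -/
def klDom (v : R → ℝ) (η : X → ℝ) (P : RMat R X) : Set (RMat R X) :=
  {Q | (∀ x ∈ optArms v P, ∀ r, Q r x = P r x) ∧
    ∀ x ∈ subFinset v P, ∀ r, 0 ≤ Q r x ∧ (0 < η x * P r x → 0 < Q r x)}

/-- The real-valued form of `distObj` on `klDom`. -/
noncomputable def klSum (v : R → ℝ) (η : X → ℝ) (P Q : RMat R X) : ℝ :=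
  ∑ x ∈ subFinset v P, ∑ r, klTerm (η x) (P r x) (Q r x)

lemma distObj_eq_klSum {v : R → ℝ} {η : X → ℝ} (hη : ∀ x, 0 ≤ η x) {P Q : RMat R X}
    (hP : P ∈ POmega) (hQ : Q ∈ klDom v η P) :
    distObj v η P Q = (klSum v η P Q : EReal) := by
  unfold distObj klSum
  rw [coe_finset_sum_eReal]
  refine Finset.sum_congr rfl fun x hx => ?_
  rcases (hη x).eq_or_lt with h | h
  · simp [← h, klTerm]
  · have hac : ∀ r, Q r x = 0 → P r x = 0 := by
      intro r hr
      by_contra hne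
      have := (hQ.2 x hx r).2 (mul_pos h ((hP.1 r x).lt_of_ne' hne))
      exact this.ne' hr
    rw [infoDiv, if_pos hac, ← EReal.coe_mul, Finset.mul_sum]
    rfl

lemma convexOn_klSum {v : R → ℝ} {η : X → ℝ} (hη : ∀ x, 0 ≤ η x) {P : RMat R X}
    (hP : P ∈ POmega) : ConvexOn ℝ (klDom v η P) (klSum v η P) := by
  refine ⟨?_, ?_⟩
  · intro Q hQ Q' hQ' s t hs ht hst
    refine ⟨fun x hx r => ?_, fun x hx r => ?_⟩
    · simp only [Pi.add_apply, Pi.smul_apply, smul_eq_mul, hQ.1 x hx r, hQ'.1 x hx r]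
      rw [← add_mul, hst, one_mul]
    · exact (convexOn_klTerm (hη x) (hP.1 r x)).1 (hQ.2 x hx r) (hQ'.2 x hx r) hs ht hst
  · intro Q hQ Q' hQ' s t hs ht hst
    simp only [klSum, smul_eq_mul, Finset.mul_sum, ← Finset.sum_add_distrib]
    refine Finset.sum_le_sum fun x hx => Finset.sum_le_sum fun r _ => ?_
    exact (convexOn_klTerm (hη x) (hP.1 r x)).2 (hQ.2 x hx r) (hQ'.2 x hx r) hs ht hst

lemma tendsto_klSum {v : R → ℝ} {η : X → ℝ} (hη : ∀ x, 0 ≤ η x) {P q : RMat R X}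
    (hP : P ∈ POmega) (hq : q ∈ klDom v η P) {Q : ℕ → RMat R X}
    (hQ : Tendsto Q atTop (nhds q)) :
    Tendsto (fun n => klSum v η P (Q n)) atTop (nhds (klSum v η P q)) := by
  refine tendsto_finsetSum _ fun x hx => tendsto_finsetSum _ fun r _ => ?_
  exact (continuousAt_klTerm (hP.1 r x) (hη x) (hq.2 x hx r).2).tendsto.comp
    (tendsto_pi_nhds.1 (tendsto_pi_nhds.1 hQ r) x)

lemma klTerm_le_klSum {v : R → ℝ} {η : X → ℝ} (hη : ∀ x, 0 ≤ η x) {P Q : RMat R X}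
    (hP : P ∈ POmega) (hQ : Q ∈ klDom v η P) {x : X} (hx : x ∈ subFinset v P) (r : R) :
    klTerm (η x) (P r x) (Q r x) ≤ klSum v η P Q := by
  have h0 : ∀ y ∈ subFinset v P, ∀ r, 0 ≤ klTerm (η y) (P r y) (Q r y) := fun y hy r =>
    klTerm_nonneg (hη y) (hP.1 r y) (hQ.2 y hy r).1 (hQ.2 y hy r).2
  calc _ ≤ ∑ r, klTerm (η x) (P r x) (Q r x) :=
        Finset.single_le_sum (f := fun r => klTerm (η x) (P r x) (Q r x))
          (fun r _ => h0 x hx r) (Finset.mem_univ r)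
    _ ≤ _ := Finset.single_le_sum (f := fun x => ∑ r, klTerm (η x) (P r x) (Q r x))
          (fun y hy => Finset.sum_nonneg fun r _ => h0 y hy r) hx

/-- The epigraph of the perturbed distance problem: `z.1` perturbs the cone constraint, `z.2.1` the
reward constraint, and `z.2.2` bounds the objective. -/
def perturbEpi (v : R → ℝ) (PP : Set (RMat R X)) (η : X → ℝ) (x' : X) (P : RMat R X) :
    Set (RMat R X × ℝ × ℝ) :=
  {z | ∃ Q ∈ klDom v η P, z.1 + Q ∈ coneP PP ∧ rewStar v P - rewOf v Q x' ≤ z.2.1 ∧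
    klSum v η P Q ≤ z.2.2}

lemma convex_perturbEpi {v : R → ℝ} {PP : Set (RMat R X)} (hconv : Convex ℝ PP) {η : X → ℝ}
    (hη : ∀ x, 0 ≤ η x) (x' : X) {P : RMat R X} (hP : P ∈ POmega) :
    Convex ℝ (perturbEpi v PP η x' P) := by
  rintro z ⟨Q, hQ, hk, hr, hf⟩ z' ⟨Q', hQ', hk', hr', hf'⟩ s t hs ht hst
  have hc := convexOn_klSum (v := v) hη hP
  refine ⟨s • Q + t • Q', hc.1 hQ hQ' hs ht hst, ?_, ?_, ?_⟩
  · have := convex_coneP hconv hk hk' hs ht hst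
    convert this using 1
    simp only [Prod.fst_add, Prod.smul_fst, smul_add]
    abel
  · rw [rewOf_add_smul]
    simp only [Prod.snd_add, Prod.smul_snd, Prod.fst_add, Prod.smul_fst, smul_eq_mul]
    have h1 := mul_le_mul_of_nonneg_left hr hs
    have h2 := mul_le_mul_of_nonneg_left hr' ht
    have h3 : rewStar v P = s * rewStar v P + t * rewStar v P := by rw [← add_mul, hst, one_mul]
    linarith
  · refine (hc.2 hQ hQ' hs ht hst).trans ?_
    simp only [Prod.snd_add, Prod.smul_snd, smul_eq_mul]
    gcongr

/-- Lower semicontinuity at the origin of the value of the perturbed problem. -/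
lemma exists_of_mem_closure_perturbEpi {v : R → ℝ} {PP : Set (RMat R X)} (hsub : PP ⊆ POmega)
    (hcomp : IsCompact PP) {η : X → ℝ} (hη : ∀ x, 0 ≤ η x) {x' : X} {P : RMat R X}
    (hP : P ∈ POmega) {c : ℝ}
    (hc : ((0 : RMat R X), (0 : ℝ), c) ∈ closure (perturbEpi v PP η x' P)) :
    ∃ q ∈ PP, q ∈ klDom v η P ∧ rewStar v P ≤ rewOf v q x' ∧ klSum v η P q ≤ c := by
  obtain ⟨z, hz, hlim⟩ := mem_closure_iff_seq_limit.1 hc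
  choose Q hQ hk hr hf using hz
  choose θ hθ q hq hzq using hk
  obtain ⟨x₀, hx₀⟩ := exists_mem_optArms v P
  have hz1 : Tendsto (fun n => (z n).1) atTop (nhds 0) := (continuous_fst.tendsto _).comp hlim
  have hz2 : Tendsto (fun n => (z n).2.1) atTop (nhds 0) :=
    ((continuous_fst.comp continuous_snd).tendsto _).comp hlim
  have hz3 : Tendsto (fun n => (z n).2.2) atTop (nhds c) :=
    ((continuous_snd.comp continuous_snd).tendsto _).comp hlim
  have hθ1 : Tendsto θ atTop (nhds 1) := by
    have he : θ = fun n => ∑ r, (z n).1 r x₀ + 1 := by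
      funext n
      have h1 : ∑ r, ((z n).1 + Q n) r x₀ = ∑ r, (θ n • q n) r x₀ := by rw [hzq]
      simp only [Pi.add_apply, Pi.smul_apply, smul_eq_mul, Finset.sum_add_distrib,
        ← Finset.mul_sum, (hsub (hq n)).2, (hQ n).1 x₀ hx₀, hP.2] at h1
      linarith
    rw [he]
    have : Tendsto (fun n => ∑ r, (z n).1 r x₀) atTop (nhds (∑ _r : R, 0)) :=
      tendsto_finsetSum _ fun r _ => tendsto_pi_nhds.1 (tendsto_pi_nhds.1 hz1 r) x₀
    simpa using this.add_const 1
  obtain ⟨q₀, hq₀, φ, hφ, hqlim⟩ := hcomp.tendsto_subseq hq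
  have hφ' := hφ.tendsto_atTop
  have hQlim : Tendsto (fun n => Q (φ n)) atTop (nhds q₀) := by
    have h1 : (fun n => Q (φ n)) = fun n => θ (φ n) • q (φ n) - (z (φ n)).1 := by
      funext n
      rw [← hzq, add_sub_cancel_left]
    rw [h1]
    simpa using ((hθ1.comp hφ').smul hqlim).sub (hz1.comp hφ')
  have hQc : ∀ r x, Tendsto (fun n => Q (φ n) r x) atTop (nhds (q₀ r x)) := fun r x =>
    tendsto_pi_nhds.1 (tendsto_pi_nhds.1 hQlim r) x
  have hdom : q₀ ∈ klDom v η P := by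
    refine ⟨fun x hx r => ?_, fun x hx r => ⟨(hsub hq₀).1 r x, fun hpos => ?_⟩⟩
    · refine tendsto_nhds_unique (hQc r x) ?_
      simp only [(hQ _).1 x hx r]
      exact tendsto_const_nhds
    · obtain ⟨δ, hδ, hδle⟩ := exists_pos_le_of_klTerm_le (pos_of_mul_pos_left hpos (hP.1 r x))
        (pos_of_mul_pos_right hpos (hη x)) (c + 1)
      refine hδ.trans_le (ge_of_tendsto (hQc r x) ?_)
      filter_upwards [(hz3.comp hφ').eventually_le_const (lt_add_one c)] with n hn
      exact hδle _ (((hQ _).2 x hx r).2 hpos)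
        (((klTerm_le_klSum hη hP (hQ _) hx r).trans (hf _)).trans hn)
  refine ⟨q₀, hq₀, hdom, ?_, ?_⟩
  · have h1 : Tendsto (fun n => rewOf v (Q (φ n)) x') atTop (nhds (rewOf v q₀ x')) :=
      tendsto_finsetSum _ fun r _ => (hQc r x').const_mul _
    have := le_of_tendsto_of_tendsto (h1.const_sub (rewStar v P)) (hz2.comp hφ')
      (Eventually.of_forall fun n => hr _)
    linarith
  · exact le_of_tendsto_of_tendsto (tendsto_klSum hη hP hdom hQlim) (hz3.comp hφ')
      (Eventually.of_forall fun n => hf _)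

/-- A lower bound on the Lagrangian (with `β = 0`) over `klDom` bounds the dual function. -/
lemma le_dualFn_of_forall_le {v : R → ℝ} {η : X → ℝ} (hη : ∀ x, 0 ≤ η x) {x' : X} {P : RMat R X}
    (hP : P ∈ POmega) (hx' : x' ∈ subFinset v P) {α c : ℝ} {l : RMat R X}
    (H : ∀ Q ∈ klDom v η P, c ≤ klSum v η P Q - ∑ x, ∑ r, l r x * Q r x +
      α * (rewStar v P - rewOf v Q x')) :
    (c : EReal) ≤ dualFn v η x' P α 0 l := by
  set s : X → R → ℝ := fun x r => η x - l r x - 0 - α * v r * (if x = x' then 1 else 0) with hs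
  set B : ℝ := -(∑ x ∈ optFinset v P, ∑ r : R, l r x * P r x) + α * rewStar v P +
    0 * ((subFinset v P).card : ℝ) with hB
  set G : X → R → ℝ → ℝ := fun x r q =>
    η x * P r x * Real.log (P r x / q) - η x * P r x + s x r * q with hG
  have H' : ∀ Q ∈ klDom v η P, c ≤ ∑ x ∈ subFinset v P, ∑ r, G x r (Q r x) + B := by
    intro Q hQ
    have h1 := sum_slack_mul v hx' hQ.1 η α 0 l
    have h2 : ∑ x ∈ subFinset v P, ∑ r, G x r (Q r x) = klSum v η P Q +
        ∑ x ∈ subFinset v P, ∑ r,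
          (η x - l r x - 0 - α * v r * (if x = x' then 1 else 0) - η x) * Q r x := by
      unfold klSum
      simp only [← Finset.sum_add_distrib]
      refine Finset.sum_congr rfl fun x _ => Finset.sum_congr rfl fun r _ => ?_
      simp only [hG, hs, klTerm]
      ring
    have h3 := H Q hQ
    rw [h2, h1, hB]
    linarith
  have hslope : ∀ x ∈ subFinset v P, ∀ r, 0 ≤ s x r ∧ (0 < η x * P r x → 0 < s x r) := by
    intro x hx r
    refine slope_nonneg_of_log_bound
      (C := c - B - ∑ x ∈ subFinset v P, ∑ r, G x r (P r x) + G x r (P r x) + η x * P r x)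
      (mul_nonneg (hη x) (hP.1 r x)) (hP.1 r x) (fun h => pos_of_mul_pos_right h (hη x))
      fun q hq => ?_
    set Q : RMat R X := fun r₁ x₁ => if r₁ = r ∧ x₁ = x then q else P r₁ x₁ with hQdef
    have hQ : Q ∈ klDom v η P := by
      refine ⟨fun y hy r₁ => ?_, fun y hy r₁ => ?_⟩
      · have : y ≠ x := by
          rintro rfl
          exact mem_subFinset.1 hx hy
        simp [hQdef, this]
      · simp only [hQdef]
        split_ifs
        · exact ⟨hq.le, fun _ => hq⟩
        · exact ⟨hP.1 _ _, fun h => pos_of_mul_pos_right h (hη y)⟩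
    have h1 : ∑ x ∈ subFinset v P, ∑ r, G x r (Q r x) -
        ∑ x ∈ subFinset v P, ∑ r, G x r (P r x) = G x r q - G x r (P r x) := by
      simp only [← Finset.sum_sub_distrib]
      rw [Finset.sum_eq_single_of_mem x hx, Finset.sum_eq_single_of_mem r (Finset.mem_univ r)]
      · simp [hQdef]
      · intro r₁ _ hr₁
        simp [hQdef, hr₁]
      · intro y _ hy
        simp [hQdef, hy]
    have h2 := H' Q hQ
    have h3 : G x r q = η x * P r x * Real.log (P r x / q) - η x * P r x + s x r * q := rfl
    linarith
  set Q : RMat R X := fun r x => if x ∈ subFinset v P then η x * P r x / s x r else P r x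
    with hQdef
  have hQ : Q ∈ klDom v η P := by
    refine ⟨fun x hx r => ?_, fun x hx r => ?_⟩
    · have : x ∉ subFinset v P := fun h => mem_subFinset.1 h hx
      simp [hQdef, this]
    · simp only [hQdef, hx, if_true]
      exact ⟨div_nonneg (mul_nonneg (hη x) (hP.1 r x)) (hslope x hx r).1,
        fun h => div_pos h ((hslope x hx r).2 h)⟩
  have hval : ∀ x ∈ subFinset v P, ∀ r, ((η x * P r x : ℝ) : EReal) * elog (s x r / η x) =
      (G x r (Q r x) : EReal) := by
    intro x hx r
    have hQx : Q r x = η x * P r x / s x r := by simp [hQdef, hx]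
    rcases (mul_nonneg (hη x) (hP.1 r x)).eq_or_lt with h | h
    · simp [hG, hQx, ← h]
    · have hsp := (hslope x hx r).2 h
      have hηp : 0 < η x := pos_of_mul_pos_left h (hP.1 r x)
      have hPp : 0 < P r x := pos_of_mul_pos_right h (hη x)
      rw [elog, if_pos (div_pos hsp hηp), ← EReal.coe_mul]
      congr 1
      have h1 : P r x / (η x * P r x / s x r) = s x r / η x := by field_simp
      have h2 : s x r * (η x * P r x / s x r) = η x * P r x := by field_simp
      simp only [hG, hQx, h1, h2]
      ring
  rw [dualFn, if_pos fun x hx r => (hslope x hx r).1]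
  have h4 : ∑ x ∈ subFinset v P, ∑ r, ((η x * P r x : ℝ) : EReal) * elog (s x r / η x) =
      ((∑ x ∈ subFinset v P, ∑ r, G x r (Q r x) : ℝ) : EReal) := by
    rw [coe_finset_sum_eReal]
    refine Finset.sum_congr rfl fun x hx => ?_
    rw [coe_finset_sum_eReal]
    exact Finset.sum_congr rfl fun r _ => hval x hx r
  change _ ≤ (∑ x ∈ subFinset v P, ∑ r, ((η x * P r x : ℝ) : EReal) * elog (s x r / η x)) +
    (B : EReal)
  rw [h4, ← EReal.coe_add]
  exact EReal.coe_le_coe_iff.2 (H' Q hQ)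

/-- A value below the infimum of the closed problem is a lower bound of the Lagrangian for some
multipliers, by separation from the epigraph of the perturbed problem. -/
lemma exists_multipliers {v : R → ℝ} {PP : Set (RMat R X)} (hconv : Convex ℝ PP) {η : X → ℝ}
    (hη : ∀ x, 0 ≤ η x) {x' : X} {P Qs : RMat R X} (hP : P ∈ POmega) (hQs : Qs ∈ PP)
    (hQsD : Qs ∈ klDom v η P) (hQsr : rewStar v P ≤ rewOf v Qs x') {c : ℝ}
    (hc : ((0 : RMat R X), (0 : ℝ), c) ∉ closure (perturbEpi v PP η x' P)) :
    ∃ (α : ℝ) (l : RMat R X), 0 ≤ α ∧ l ∈ dualConeP PP ∧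
      ∀ Q ∈ klDom v η P, c ≤ klSum v η P Q - ∑ x, ∑ r, l r x * Q r x +
        α * (rewStar v P - rewOf v Q x') := by
  obtain ⟨φ, u, hu, hφ⟩ := geometric_hahn_banach_point_closed
    (convex_perturbEpi hconv hη x' hP).closure isClosed_closure hc
  obtain ⟨m, hm⟩ := exists_pairing_eq
    (φ.toLinearMap ∘ₗ LinearMap.inl ℝ (RMat R X) (ℝ × ℝ))
  set a := φ (0, 1, 0) with ha
  set τ := φ (0, 0, 1) with hτ
  have hdec : ∀ W s t, φ (W, s, t) = ∑ x, ∑ r, m r x * W r x + s * a + t * τ := by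
    intro W s t
    have h1 : ((W, s, t) : RMat R X × ℝ × ℝ) =
        (W, 0) + s • ((0 : RMat R X), (1 : ℝ), (0 : ℝ)) +
          t • ((0 : RMat R X), (0 : ℝ), (1 : ℝ)) := by
      ext <;> simp
    rw [h1, map_add, map_add, map_smul, map_smul, ← hm]
    simp [ha, hτ]
  have hlow : ∀ Q ∈ klDom v η P, ∀ k ∈ coneP PP, ∀ s t, rewStar v P - rewOf v Q x' ≤ s →
      klSum v η P Q ≤ t →
      c * τ < ∑ x, ∑ r, m r x * k r x - ∑ x, ∑ r, m r x * Q r x + s * a + t * τ := by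
    intro Q hQ k hk s t hs ht
    have h1 := hu.trans (hφ (k - Q, s, t) (subset_closure ⟨Q, hQ, by simpa using hk, hs, ht⟩))
    rw [hdec, hdec] at h1
    simpa [mul_sub, Finset.sum_sub_distrib] using h1
  have hcone : ∀ θ : ℝ, 0 ≤ θ → ∀ k ∈ coneP PP, θ • k ∈ coneP PP := by
    rintro θ hθ _ ⟨θ', hθ', q, hq, rfl⟩
    exact ⟨θ * θ', mul_nonneg hθ hθ', q, hq, smul_smul _ _ _⟩
  have hQsK : Qs ∈ coneP PP := ⟨1, zero_le_one, Qs, hQs, (one_smul _ _).symm⟩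
  have h0K : (0 : RMat R X) ∈ coneP PP := ⟨0, le_rfl, Qs, hQs, (zero_smul _ _).symm⟩
  have hray : ∀ C d : ℝ, (∀ θ : ℝ, 0 ≤ θ → C < θ * d) → 0 ≤ d := by
    intro C d h
    by_contra! hd
    have h1 := h (|C| / (-d)) (div_nonneg (abs_nonneg _) (by linarith))
    have h2 : |C| / (-d) * d = -|C| := by
      rw [div_neg, neg_mul, div_mul_cancel₀ _ hd.ne]
    have := neg_abs_le C
    linarith
  have hτ0 : 0 ≤ τ := by
    refine hray (c * τ - klSum v η P Qs * τ) τ fun θ hθ => ?_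
    have := hlow Qs hQsD Qs hQsK 0 (klSum v η P Qs + θ) (by linarith) (by linarith)
    linarith
  have ha0 : 0 ≤ a := by
    refine hray (c * τ - klSum v η P Qs * τ) a fun θ hθ => ?_
    have := hlow Qs hQsD Qs hQsK θ (klSum v η P Qs) (by linarith) le_rfl
    linarith
  have hτpos : 0 < τ := by
    refine hτ0.lt_of_ne fun h => ?_
    have := hlow Qs hQsD Qs hQsK 0 (klSum v η P Qs) (by linarith) le_rfl
    rw [← h] at this
    simp at this
  have hmK : ∀ k ∈ coneP PP, 0 ≤ ∑ x, ∑ r, m r x * k r x := by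
    intro k hk
    refine hray (c * τ - klSum v η P Qs * τ + ∑ x, ∑ r, m r x * Qs r x) _ fun θ hθ => ?_
    have := hlow Qs hQsD (θ • k) (hcone θ hθ k hk) 0 (klSum v η P Qs) (by linarith) le_rfl
    have h2 : ∑ x, ∑ r, m r x * (θ • k) r x = θ * ∑ x, ∑ r, m r x * k r x := by
      simp only [Finset.mul_sum, Pi.smul_apply, smul_eq_mul, mul_left_comm]
    linarith
  have hscale : ∀ k : RMat R X,
      ∑ x, ∑ r, (τ⁻¹ • m) r x * k r x = τ⁻¹ * ∑ x, ∑ r, m r x * k r x := fun k => by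
    simp only [Finset.mul_sum, Pi.smul_apply, smul_eq_mul, mul_assoc]
  refine ⟨τ⁻¹ * a, τ⁻¹ • m, by positivity, fun k hk => ?_, fun Q hQ => ?_⟩
  · rw [hscale]
    exact mul_nonneg (inv_nonneg.2 hτ0) (hmK k hk)
  · rw [hscale]
    have h1 := hlow Q hQ 0 h0K _ _ le_rfl le_rfl
    simp only [Pi.zero_apply, mul_zero, Finset.sum_const_zero, zero_sub] at h1
    have h2 := mul_lt_mul_of_pos_left h1 (inv_pos.2 hτpos)
    have h3 : τ⁻¹ * (c * τ) = c := by field_simp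
    have h4 : τ⁻¹ * (klSum v η P Q * τ) = klSum v η P Q := by field_simp
    rw [h3, mul_add, mul_add, h4] at h2
    linarith

/-- A deceitful arm admits a strictly deceitful distribution dominating `P`. -/
lemma exists_mem_DeceitSet_klDom {v : R → ℝ} {PP : Set (RMat R X)} (hsub : PP ⊆ POmega)
    (hconv : Convex ℝ PP) {η : X → ℝ} (hη : ∀ x, 0 ≤ η x) {x' : X} {P : RMat R X} (hP : P ∈ PP)
    (hx' : x' ∈ deceitArms v PP P) :
    ∃ Q ∈ PP, Q ∈ klDom v η P ∧ rewStar v P < rewOf v Q x' := by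
  obtain ⟨_, ⟨Q, hQ, hQP, rfl⟩, hlt⟩ := exists_lt_of_lt_csSup
    (s := {c : ℝ | ∃ Q ∈ PP, (∀ x ∈ optArms v P, ∀ r, Q r x = P r x) ∧ c = rewOf v Q x'})
    ⟨_, P, hP, fun _ _ _ => rfl, rfl⟩ hx'.2
  have hcont : Tendsto (fun t : ℝ => t * rewOf v P x' + (1 - t) * rewOf v Q x')
      (nhdsWithin 0 (Set.Ioi 0)) (nhds (rewOf v Q x')) := by
    have : Continuous fun t : ℝ => t * rewOf v P x' + (1 - t) * rewOf v Q x' := by fun_prop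
    simpa using (this.tendsto 0).mono_left nhdsWithin_le_nhds
  obtain ⟨t, ht, ht0, ht1⟩ := ((hcont.eventually_const_lt hlt).and
    (Ioo_mem_nhdsGT (zero_lt_one' ℝ))).exists
  refine ⟨t • P + (1 - t) • Q, hconv hP hQ ht0.le (by linarith) (by ring),
    ⟨fun x hx r => ?_, fun x _ r => ?_⟩, ?_⟩
  · simp only [Pi.add_apply, Pi.smul_apply, smul_eq_mul, hQP x hx r]
    ring
  · have h1 : 0 ≤ (1 - t) * Q r x := mul_nonneg (by linarith) ((hsub hQ).1 r x)
    have h2 : 0 ≤ t * P r x := mul_nonneg ht0.le ((hsub hP).1 r x)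
    simp only [Pi.add_apply, Pi.smul_apply, smul_eq_mul]
    refine ⟨by linarith, fun h => ?_⟩
    have := mul_pos ht0 (pos_of_mul_pos_right h (hη x))
    linarith
  · rwa [rewOf_add_smul]

/-- `Dist` is a lower bound of the objective under the non-strict reward constraint. -/
lemma le_klSum_of_lt_DistFn {v : R → ℝ} {PP : Set (RMat R X)} (hconv : Convex ℝ PP) {η : X → ℝ}
    (hη : ∀ x, 0 ≤ η x) {x' : X} {P q Qs : RMat R X} (hP : P ∈ POmega) (hQs : Qs ∈ PP)
    (hQsD : Qs ∈ klDom v η P) (hQsr : rewStar v P < rewOf v Qs x') (hq : q ∈ PP)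
    (hqD : q ∈ klDom v η P) (hqr : rewStar v P ≤ rewOf v q x') {c : ℝ}
    (hc : (c : EReal) < DistFn v PP η x' P) : c ≤ klSum v η P q := by
  have hK := convexOn_klSum (v := v) hη hP
  have hcont : Tendsto (fun t : ℝ => t * klSum v η P Qs + (1 - t) * klSum v η P q)
      (nhdsWithin 0 (Set.Ioi 0)) (nhds (klSum v η P q)) := by
    have : Continuous fun t : ℝ => t * klSum v η P Qs + (1 - t) * klSum v η P q := by fun_prop
    simpa using (this.tendsto 0).mono_left nhdsWithin_le_nhds
  refine ge_of_tendsto hcont ?_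
  filter_upwards [Ioo_mem_nhdsGT (zero_lt_one' ℝ)] with t ⟨ht0, ht1⟩
  have ht1' : 0 ≤ 1 - t := by linarith
  have hD := hK.1 hQsD hqD ht0.le ht1' (by ring)
  refine le_trans ?_ (hK.2 hQsD hqD ht0.le ht1' (by ring))
  have hmem : t • Qs + (1 - t) • q ∈ DeceitSet v PP x' P := by
    refine ⟨hconv hQs hq ht0.le ht1' (by ring), hD.1, fun x hx => ?_⟩
    rw [rewOf_congr (hD.1 x hx), show rewOf v P x = rewStar v P from hx, rewOf_add_smul]
    have h1 := mul_lt_mul_of_pos_left hQsr ht0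
    have h2 := mul_le_mul_of_nonneg_left hqr ht1'
    linarith
  have h := hc.le.trans (sInf_le (Set.mem_image_of_mem (distObj v η P) hmem))
  rw [distObj_eq_klSum hη hP hD] at h
  exact EReal.coe_le_coe_iff.1 h

end Duality

/-- weak and strong duality for the distance function.
(i) For every `P ∈ 𝒫_Ω`, arm `x'`, rate `η ≥ 0` and dual vector `μ = (α, β, λ) ∈ ℝ₊ × ℝ × 𝒦*`
we have `Dual(η, x', P; μ) ≤ Dist(η, x', P)`.
(ii) For every `P ∈ 𝒫` and deceitful arm `x' ∈ X̃_d(P)`,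
`Dist(η, x', P) = sup { Dual(η, x', P; μ) : μ ∈ ℝ₊ × ℝ × 𝒦* }`. -/
theorem dist_duality
    {R X : Type*} [Fintype R] [Fintype X] [Nonempty X]
    (v : R → ℝ) (hv : ∀ r, 0 ≤ v r)
    (PP : Set (RMat R X)) (hsub : PP ⊆ POmega) (hconv : Convex ℝ PP)
    (hcomp : IsCompact PP) (hne : (relIntIn POmega PP).Nonempty) :
    (∀ P ∈ (POmega : Set (RMat R X)), ∀ x' : X, ∀ η : X → ℝ, (∀ x, 0 ≤ η x) →
      ∀ (α β : ℝ) (l : RMat R X), 0 ≤ α → l ∈ dualConeP PP →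
        dualFn v η x' P α β l ≤ DistFn v PP η x' P) ∧
    (∀ P ∈ PP, ∀ x' ∈ deceitArms v PP P, ∀ η : X → ℝ, (∀ x, 0 ≤ η x) →
      DistFn v PP η x' P =
        sSup {d : EReal | ∃ (α β : ℝ) (l : RMat R X),
          0 ≤ α ∧ l ∈ dualConeP PP ∧ d = dualFn v η x' P α β l}) := by
  refine ⟨fun P hP x' η hη α β l hα hl => dualFn_le_DistFn hsub hP x' hη β hα hl,
    fun P hP x' hx' η hη => le_antisymm ?_ ?_⟩
  · have hPΩ := hsub hP
    obtain ⟨Qs, hQs, hQsD, hQsr⟩ := exists_mem_DeceitSet_klDom hsub hconv hη hP hx'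
    refine EReal.ge_of_forall_gt_iff_ge.1 fun c hc => ?_
    obtain ⟨d, hcd, hd⟩ := EReal.lt_iff_exists_real_btwn.1 hc
    have hnot : ((0 : RMat R X), (0 : ℝ), c) ∉ closure (perturbEpi v PP η x' P) := by
      intro h
      obtain ⟨q, hq, hqD, hqr, hqc⟩ := exists_of_mem_closure_perturbEpi hsub hcomp hη hPΩ h
      have h1 := le_klSum_of_lt_DistFn hconv hη hPΩ hQs hQsD hQsr hq hqD hqr hd
      have h2 := EReal.coe_lt_coe_iff.1 hcd
      linarith
    obtain ⟨α, l, hα, hl, hL⟩ := exists_multipliers hconv hη hPΩ hQs hQsD hQsr.le hnot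
    exact (le_dualFn_of_forall_le hη hPΩ (mem_subFinset.2 hx'.1) hL).trans
      (le_sSup ⟨α, 0, l, hα, hl, rfl⟩)
  · refine sSup_le ?_
    rintro _ ⟨α, β, l, hα, hl, rfl⟩
    exact dualFn_le_DistFn hsub (hsub hP) x' hη β hα hl

end Bandit
end
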